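/- Let Φ be a real N×K matrix, M ≥ K, and μ > 0. For an injective map s : Fin M → Fin N write Φ_S = Φ.submatrix s id and define F(s) = Tr[(((Φ Φᵀ + μ I_N).submatrix s s))⁻¹] and G(s) = Tr[(Φ_Sᵀ Φ_S + μ I_K)⁻¹]. Then for any two injective maps s₁, s₂ : Fin M → Fin N such that rank(Φ_{S₁}) = K and rank(Φ_{S₂}) = K, one has F(s₁) ≤ F(s₂) if and only if G(s₁) ≤ G(s₂). In particular, a sampling set of size M with full column rank that minimizes G among all such sampling sets also minimizes F, and vice versa. -/

import Mathlib

open Matrix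

/-- The submatrix objective `F(s) = Tr[((Φ Φᵀ + μ I_N).submatrix s s)⁻¹]`. -/
noncomputable def Fobj (N M K : ℕ) (Φ : Matrix (Fin N) (Fin K) ℝ) (μ : ℝ)
    (s : Fin M → Fin N) : ℝ :=
  (((Φ * Φᵀ + μ • (1 : Matrix (Fin N) (Fin N) ℝ)).submatrix s s)⁻¹).trace

/-- The shifted A-optimality objective `G(s) = Tr[(Φ_Sᵀ Φ_S + μ I_K)⁻¹]`
where `Φ_S = Φ.submatrix s id`. -/
noncomputable def Gobj (N M K : ℕ) (Φ : Matrix (Fin N) (Fin K) ℝ) (μ : ℝ)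
    (s : Fin M → Fin N) : ℝ :=
  (((Φ.submatrix s id)ᵀ * (Φ.submatrix s id)
      + μ • (1 : Matrix (Fin K) (Fin K) ℝ))⁻¹).trace

theorem Matrix.isUnit_det_mul_transpose_add_smul_one {m n : Type*} [Fintype m] [Fintype n]
    [DecidableEq m] (A : Matrix m n ℝ) {μ : ℝ} (hμ : 0 < μ) :
    IsUnit (A * Aᵀ + μ • (1 : Matrix m m ℝ)).det := by
  have hA : (A * Aᵀ).PosSemidef := by
    simpa [conjTranspose_eq_transpose_of_trivial] using posSemidef_self_mul_conjTranspose A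
  exact (PosDef.posSemidef_add hA (PosDef.one.smul hμ)).det_pos.ne'.isUnit

theorem Matrix.trace_inv_mul_transpose_add_smul_one {m n : Type*} [Fintype m] [Fintype n]
    [DecidableEq m] [DecidableEq n] (A : Matrix m n ℝ) {μ : ℝ} (hμ : 0 < μ) :
    μ * ((A * Aᵀ + μ • (1 : Matrix m m ℝ))⁻¹).trace =
      Fintype.card m - Fintype.card n + μ * ((Aᵀ * A + μ • (1 : Matrix n n ℝ))⁻¹).trace := by
  have hX := isUnit_det_mul_transpose_add_smul_one A hμ
  have hY := isUnit_det_mul_transpose_add_smul_one Aᵀ hμ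
  rw [transpose_transpose] at hY
  have hXA : (A * Aᵀ + μ • (1 : Matrix m m ℝ)) * A = A * (Aᵀ * A + μ • (1 : Matrix n n ℝ)) := by
    simp [Matrix.add_mul, Matrix.mul_add, Matrix.mul_assoc]
  have hX₁ := congrArg trace (nonsing_inv_mul _ hX)
  have hY₁ := congrArg trace (nonsing_inv_mul _ hY)
  rw [Matrix.mul_add, trace_add, trace_one, Matrix.mul_smul, Matrix.mul_one, trace_smul,
    smul_eq_mul] at hX₁ hY₁
  generalize A * Aᵀ + μ • (1 : Matrix m m ℝ) = X at *
  generalize Aᵀ * A + μ • (1 : Matrix n n ℝ) = Y at *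
  have hpush : X⁻¹ * A = A * Y⁻¹ := by
    calc X⁻¹ * A = X⁻¹ * (A * Y) * Y⁻¹ := by
          rw [← Matrix.mul_assoc, mul_nonsing_inv_cancel_right _ _ hY]
      _ = A * Y⁻¹ := by rw [← hXA, nonsing_inv_mul_cancel_left _ _ hX]
  have htr : (X⁻¹ * (A * Aᵀ)).trace = (Y⁻¹ * (Aᵀ * A)).trace := by
    rw [← Matrix.mul_assoc, hpush, Matrix.mul_assoc, trace_mul_comm, Matrix.mul_assoc]
  linarith

theorem mul_Fobj_eq (N M K : ℕ) (Φ : Matrix (Fin N) (Fin K) ℝ) {μ : ℝ} (hμ : 0 < μ)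
    {s : Fin M → Fin N} (hs : Function.Injective s) :
    μ * Fobj N M K Φ μ s = M - K + μ * Gobj N M K Φ μ s := by
  have h : (Φ * Φᵀ + μ • (1 : Matrix (Fin N) (Fin N) ℝ)).submatrix s s =
      Φ.submatrix s id * (Φ.submatrix s id)ᵀ + μ • (1 : Matrix (Fin M) (Fin M) ℝ) := by
    rw [← submatrix_one s hs]
    rfl
  simpa [Fobj, Gobj, h] using trace_inv_mul_transpose_add_smul_one (Φ.submatrix s id) hμ

theorem Fobj_le_Fobj_iff (N M K : ℕ) (Φ : Matrix (Fin N) (Fin K) ℝ) {μ : ℝ} (hμ : 0 < μ)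
    {s₁ s₂ : Fin M → Fin N} (h₁ : Function.Injective s₁) (h₂ : Function.Injective s₂) :
    Fobj N M K Φ μ s₁ ≤ Fobj N M K Φ μ s₂ ↔ Gobj N M K Φ μ s₁ ≤ Gobj N M K Φ μ s₂ := by
  rw [← mul_le_mul_iff_right₀ hμ, mul_Fobj_eq N M K Φ hμ h₁, mul_Fobj_eq N M K Φ hμ h₂,
    add_le_add_iff_left, mul_le_mul_iff_right₀ hμ]

/-- For any two injective sampling maps `s₁, s₂ : Fin M → Fin N` with full-column-rank
sampled matrices, `F(s₁) ≤ F(s₂) ↔ G(s₁) ≤ G(s₂)`; in particular, a full-column-rank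
sampling set minimizing `G` among all such sampling sets also minimizes `F`, and
vice versa. -/
theorem F_le_iff_G_le (N M K : ℕ) (hMK : K ≤ M) (Φ : Matrix (Fin N) (Fin K) ℝ)
    (μ : ℝ) (hμ : 0 < μ) :
    (∀ s₁ s₂ : Fin M → Fin N, Function.Injective s₁ → Function.Injective s₂ →
      (Φ.submatrix s₁ id).rank = K → (Φ.submatrix s₂ id).rank = K →
      (Fobj N M K Φ μ s₁ ≤ Fobj N M K Φ μ s₂ ↔ Gobj N M K Φ μ s₁ ≤ Gobj N M K Φ μ s₂)) ∧
    (∀ s₁ : Fin M → Fin N, Function.Injective s₁ → (Φ.submatrix s₁ id).rank = K →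
      ((∀ s₂ : Fin M → Fin N, Function.Injective s₂ → (Φ.submatrix s₂ id).rank = K →
          Gobj N M K Φ μ s₁ ≤ Gobj N M K Φ μ s₂) ↔
        (∀ s₂ : Fin M → Fin N, Function.Injective s₂ → (Φ.submatrix s₂ id).rank = K →
          Fobj N M K Φ μ s₁ ≤ Fobj N M K Φ μ s₂))) := by
  exact ⟨fun s₁ s₂ h₁ h₂ _ _ => Fobj_le_Fobj_iff N M K Φ hμ h₁ h₂, fun s₁ h₁ _ =>
    forall_congr' fun s₂ => forall_congr' fun h₂ => forall_congr' fun _ =>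
      (Fobj_le_Fobj_iff N M K Φ hμ h₁ h₂).symm⟩
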